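/- Admissibility of the reflection rule: if □A is derivable in the natural deduction system IEL⁻ with no open hypotheses, then A is derivable in IEL⁻ with no open hypotheses. -/

import Mathlib

/-- Formulas of intuitionistic epistemic logic. -/
inductive Formula : Type
  | atom : ℕ → Formula
  | bot : Formula
  | top : Formula
  | and : Formula → Formula → Formula
  | or : Formula → Formula → Formula
  | impl : Formula → Formula → Formula
  | box : Formula → Formula
  deriving DecidableEq

namespace Formula

/-- Negation is defined: ¬A := A → ⊥. -/
def neg (A : Formula) : Formula := A.impl .bot

end Formula

/-- The natural deduction system IEL⁻: the propositional fragment of NJ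
extended by the □-introduction rule. -/
inductive ND : Set Formula → Formula → Prop
  | hyp {Γ : Set Formula} {A : Formula} : A ∈ Γ → ND Γ A
  | top_intro {Γ : Set Formula} : ND Γ Formula.top
  | bot_elim {Γ : Set Formula} {A : Formula} : ND Γ Formula.bot → ND Γ A
  | and_intro {Γ : Set Formula} {A B : Formula} : ND Γ A → ND Γ B → ND Γ (A.and B)
  | and_elim_left {Γ : Set Formula} {A B : Formula} : ND Γ (A.and B) → ND Γ A
  | and_elim_right {Γ : Set Formula} {A B : Formula} : ND Γ (A.and B) → ND Γ B
  | impl_intro {Γ : Set Formula} {A B : Formula} : ND (insert A Γ) B → ND Γ (A.impl B)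
  | impl_elim {Γ : Set Formula} {A B : Formula} : ND Γ (A.impl B) → ND Γ A → ND Γ B
  | or_intro_left {Γ : Set Formula} {A B : Formula} : ND Γ A → ND Γ (A.or B)
  | or_intro_right {Γ : Set Formula} {A B : Formula} : ND Γ B → ND Γ (A.or B)
  | or_elim {Γ : Set Formula} {A B C : Formula} :
      ND Γ (A.or B) → ND (insert A Γ) C → ND (insert B Γ) C → ND Γ C
  | box_intro {ps : List (Set Formula × Formula)} {Δ : Set Formula} {B : Formula} :
      (∀ p ∈ ps, ND p.1 (Formula.box p.2)) →
      ND ({A | ∃ p ∈ ps, p.2 = A} ∪ Δ) B →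
      ND ((⋃ p ∈ ps, p.1) ∪ Δ) (Formula.box B)


namespace ND

/-- A form of the □-introduction rule with a single shared context. -/
theorem box_intro_shared {Γ : Set Formula} {ps : List (Set Formula × Formula)} {B : Formula}
    (hps : ∀ p ∈ ps, ND Γ p.2.box) (hB : ND ({A | ∃ p ∈ ps, p.2 = A} ∪ Γ) B) :
    ND Γ B.box := by
  have h := box_intro (ps := ps.map fun p => (Γ, p.2)) (Δ := Γ) (B := B)
    (by simpa only [List.forall_mem_map] using hps) (by simpa using hB)
  have hΓ : (⋃ p ∈ ps.map fun p => (Γ, p.2), p.1) ∪ Γ = Γ := by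
    ext C
    simp only [Set.mem_union, Set.mem_iUnion, List.mem_map]
    constructor
    · rintro (⟨_, ⟨_, _, rfl⟩, h⟩ | h) <;> exact h
    · exact Or.inr
  rwa [hΓ] at h

theorem weaken {Γ Γ' : Set Formula} {A : Formula} (h : ND Γ A) (hΓ : Γ ⊆ Γ') : ND Γ' A := by
  induction h generalizing Γ' with
  | hyp h => exact hyp (hΓ h)
  | top_intro => exact top_intro
  | bot_elim _ ih => exact bot_elim (ih hΓ)
  | and_intro _ _ ih₁ ih₂ => exact and_intro (ih₁ hΓ) (ih₂ hΓ)
  | and_elim_left _ ih => exact and_elim_left (ih hΓ)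
  | and_elim_right _ ih => exact and_elim_right (ih hΓ)
  | impl_intro _ ih => exact impl_intro (ih (Set.insert_subset_insert hΓ))
  | impl_elim _ _ ih₁ ih₂ => exact impl_elim (ih₁ hΓ) (ih₂ hΓ)
  | or_intro_left _ ih => exact or_intro_left (ih hΓ)
  | or_intro_right _ ih => exact or_intro_right (ih hΓ)
  | or_elim _ _ _ ih₁ ih₂ ih₃ =>
    exact or_elim (ih₁ hΓ) (ih₂ (Set.insert_subset_insert hΓ))
      (ih₃ (Set.insert_subset_insert hΓ))
  | box_intro _ _ ih₁ ih₂ =>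
    obtain ⟨hps, hΔ⟩ := Set.union_subset_iff.1 hΓ
    exact box_intro_shared (fun p hp => ih₁ p hp (Set.iUnion₂_subset_iff.1 hps p hp))
      (ih₂ (Set.union_subset_union_right _ hΔ))

theorem forall_insert {Γ Γ' : Set Formula} (A : Formula) (hΓ : ∀ B ∈ Γ, ND Γ' B) :
    ∀ B ∈ insert A Γ, ND (insert A Γ') B := by
  rintro B (rfl | hB)
  · exact hyp (Set.mem_insert _ _)
  · exact (hΓ B hB).weaken (Set.subset_insert _ _)

/-- Deductions may be substituted for open hypotheses. -/
theorem subst {Γ Γ' : Set Formula} {A : Formula} (h : ND Γ A) (hΓ : ∀ B ∈ Γ, ND Γ' B) :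
    ND Γ' A := by
  induction h generalizing Γ' with
  | hyp h => exact hΓ _ h
  | top_intro => exact top_intro
  | bot_elim _ ih => exact bot_elim (ih hΓ)
  | and_intro _ _ ih₁ ih₂ => exact and_intro (ih₁ hΓ) (ih₂ hΓ)
  | and_elim_left _ ih => exact and_elim_left (ih hΓ)
  | and_elim_right _ ih => exact and_elim_right (ih hΓ)
  | impl_intro _ ih => exact impl_intro (ih (forall_insert _ hΓ))
  | impl_elim _ _ ih₁ ih₂ => exact impl_elim (ih₁ hΓ) (ih₂ hΓ)
  | or_intro_left _ ih => exact or_intro_left (ih hΓ)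
  | or_intro_right _ ih => exact or_intro_right (ih hΓ)
  | or_elim _ _ _ ih₁ ih₂ ih₃ =>
    exact or_elim (ih₁ hΓ) (ih₂ (forall_insert _ hΓ)) (ih₃ (forall_insert _ hΓ))
  | box_intro _ _ ih₁ ih₂ =>
    refine box_intro_shared
      (fun p hp => ih₁ p hp fun C hC => hΓ C (Or.inl (Set.mem_biUnion hp hC))) (ih₂ ?_)
    rintro C (hC | hC)
    · exact hyp (Or.inl hC)
    · exact (hΓ C (Or.inr hC)).weaken Set.subset_union_right

end ND

namespace Formula

/-- The Kleene–Aczel slash for IEL⁻ with the empty context. -/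
def Slash : Formula → Prop
  | atom n => ND ∅ (atom n)
  | bot => False
  | top => True
  | and A B => A.Slash ∧ B.Slash
  | or A B => A.Slash ∨ B.Slash
  | impl A B => ND ∅ (A.impl B) ∧ (A.Slash → B.Slash)
  | box A => A.Slash

theorem Slash.derivable {A : Formula} (h : A.Slash) : ND ∅ A := by
  induction A with
  | atom n => exact h
  | bot => exact h.elim
  | top => exact .top_intro
  | and A B ihA ihB => exact .and_intro (ihA h.1) (ihB h.2)
  | or A B ihA ihB =>
    exact Or.elim h (fun h => .or_intro_left (ihA h)) (fun h => .or_intro_right (ihB h))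
  | impl A B => exact h.1
  | box A ih => exact ND.box_intro_shared (ps := []) (by simp) (by simpa using ih h)

end Formula

/-- Soundness of IEL⁻ for the slash. -/
theorem ND.slash {Γ : Set Formula} {A : Formula} (h : ND Γ A) (hΓ : ∀ B ∈ Γ, B.Slash) :
    A.Slash := by
  induction h with
  | hyp h => exact hΓ _ h
  | top_intro => trivial
  | bot_elim _ ih => exact (ih hΓ).elim
  | and_intro _ _ ih₁ ih₂ => exact ⟨ih₁ hΓ, ih₂ hΓ⟩
  | and_elim_left _ ih => exact (ih hΓ).1
  | and_elim_right _ ih => exact (ih hΓ).2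
  | impl_intro h ih =>
    exact ⟨(impl_intro h).subst fun B hB => (hΓ B hB).derivable,
      fun hA => ih (Set.forall_mem_insert.2 ⟨hA, hΓ⟩)⟩
  | impl_elim _ _ ih₁ ih₂ => exact (ih₁ hΓ).2 (ih₂ hΓ)
  | or_intro_left _ ih => exact Or.inl (ih hΓ)
  | or_intro_right _ ih => exact Or.inr (ih hΓ)
  | or_elim _ _ _ ih₁ ih₂ ih₃ =>
    exact Or.elim (ih₁ hΓ) (fun hA => ih₂ (Set.forall_mem_insert.2 ⟨hA, hΓ⟩))
      (fun hB => ih₃ (Set.forall_mem_insert.2 ⟨hB, hΓ⟩))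
  | box_intro _ _ ih₁ ih₂ =>
    refine ih₂ ?_
    rintro C (⟨p, hp, rfl⟩ | hC)
    · exact ih₁ p hp fun D hD => hΓ D (Or.inl (Set.mem_biUnion hp hD))
    · exact hΓ C (Or.inr hC)

/-- the reflection rule is admissible in IEL⁻. -/
theorem reflection_admissible (A : Formula) (h : ND ∅ (Formula.box A)) :
    ND ∅ A := by
  exact Formula.Slash.derivable (A := A) (h.slash (by simp))
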